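/- Let (M, F, C, W) be a model category, let K be a bicomplete category, and let V : K ⇄ M : R be an adjunction with V left adjoint to R. Write V⁻¹C, V⁻¹W, V⁻¹(C ∩ W) for the classes of morphisms of K carried by V into C, W, C ∩ W respectively, and rlp(X) for the class of morphisms having the right lifting property with respect to every morphism of X. Assume that the pairs (V⁻¹C, rlp(V⁻¹C)) and (V⁻¹(C ∩ W), rlp(V⁻¹(C ∩ W))) are weak factorization systems on K. Then K admits a model structure with cofibrations V⁻¹C, weak equivalences V⁻¹W, and fibrations rlp(V⁻¹(C ∩ W)) if and only if rlp(V⁻¹C) ⊆ V⁻¹W. -/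

import Mathlib

open CategoryTheory Limits

universe v₁ u₁ v₂ u₂ v₃ u₃ v₄ u₄

namespace InducedModel

variable {M : Type u₁} [Category.{v₁} M]

/-- The class of morphisms having the left lifting property with respect to
every morphism in `R`. -/
def llp (R : MorphismProperty M) : MorphismProperty M :=
  fun _ _ f => ∀ ⦃X Y : M⦄ (g : X ⟶ Y), R g → HasLiftingProperty f g

/-- The class of morphisms having the right lifting property with respect to
every morphism in `L`. -/
def rlp (L : MorphismProperty M) : MorphismProperty M :=
  fun _ _ g => ∀ ⦃X Y : M⦄ (f : X ⟶ Y), L f → HasLiftingProperty f g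

/-- `(L, R)` is a weak factorization system. -/
structure IsWFS (L R : MorphismProperty M) : Prop where
  factor : ∀ ⦃X Y : M⦄ (f : X ⟶ Y),
    ∃ (Z : M) (i : X ⟶ Z) (p : Z ⟶ Y), L i ∧ R p ∧ i ≫ p = f
  left_eq : L = llp R
  right_eq : R = rlp L

/-- `W` satisfies the 2-of-3 property. -/
def TwoOfThree (W : MorphismProperty M) : Prop :=
  (∀ ⦃X Y Z : M⦄ (f : X ⟶ Y) (g : Y ⟶ Z), W f → W g → W (f ≫ g)) ∧
  (∀ ⦃X Y Z : M⦄ (f : X ⟶ Y) (g : Y ⟶ Z), W g → W (f ≫ g) → W f) ∧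
  (∀ ⦃X Y Z : M⦄ (f : X ⟶ Y) (g : Y ⟶ Z), W f → W (f ≫ g) → W g)

/-- `P` is closed under retracts (in the arrow category). -/
def RetractClosed (P : MorphismProperty M) : Prop :=
  ∀ ⦃X Y X' Y' : M⦄ (f : X ⟶ Y) (g : X' ⟶ Y'),
    (∃ (i : Arrow.mk f ⟶ Arrow.mk g) (r : Arrow.mk g ⟶ Arrow.mk f), i ≫ r = 𝟙 _) →
    P g → P f

/-- Quillen's axioms for a model category structure with fibrations `F`,
cofibrations `C` and weak equivalences `W`. -/
structure IsModelCategory (F C W : MorphismProperty M) : Prop where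
  two_of_three : TwoOfThree W
  retract_fib : RetractClosed F
  retract_cof : RetractClosed C
  retract_weq : RetractClosed W
  lift_acof_fib : ∀ ⦃A B X Y : M⦄ (i : A ⟶ B) (p : X ⟶ Y),
    C i → W i → F p → HasLiftingProperty i p
  lift_cof_afib : ∀ ⦃A B X Y : M⦄ (i : A ⟶ B) (p : X ⟶ Y),
    C i → F p → W p → HasLiftingProperty i p
  fact_acof_fib : ∀ ⦃X Y : M⦄ (f : X ⟶ Y),
    ∃ (Z : M) (i : X ⟶ Z) (p : Z ⟶ Y), C i ∧ W i ∧ F p ∧ i ≫ p = f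
  fact_cof_afib : ∀ ⦃X Y : M⦄ (f : X ⟶ Y),
    ∃ (Z : M) (i : X ⟶ Z) (p : Z ⟶ Y), C i ∧ F p ∧ W p ∧ i ≫ p = f

end InducedModel

namespace InducedModel

theorem retractClosed_iff_isStableUnderRetracts {M : Type u₁} [Category.{v₁} M]
    {P : MorphismProperty M} : RetractClosed P ↔ P.IsStableUnderRetracts := by
  refine ⟨fun hP => ⟨fun h hg => hP _ _ ⟨h.i, h.r, h.retract⟩ hg⟩, ?_⟩
  rintro hP X Y X' Y' f g ⟨i, r, hir⟩ hg
  exact MorphismProperty.of_retract (show RetractArrow f g from ⟨i, r, hir⟩) hg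

theorem retractClosed_rlp {M : Type u₁} [Category.{v₁} M] (L : MorphismProperty M) :
    RetractClosed (rlp L) :=
  retractClosed_iff_isStableUnderRetracts.2
    (inferInstanceAs (MorphismProperty.rlp L).IsStableUnderRetracts)

theorem rlp_antitone {M : Type u₁} [Category.{v₁} M] {L L' : MorphismProperty M}
    (h : L ≤ L') : rlp L' ≤ rlp L :=
  fun _ _ _ hg _ _ f hf => hg f (h _ hf)

/-- The retract argument. -/
theorem RetractClosed.of_hasLiftingProperty {M : Type u₁} [Category.{v₁} M]
    {P : MorphismProperty M} (hP : RetractClosed P) {X Y Z : M} {i : X ⟶ Z} {p : Z ⟶ Y}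
    {f : X ⟶ Y} (hf : i ≫ p = f) (hif : HasLiftingProperty i f) (hp : P p) : P f := by
  let h := RetractArrow.ofRightLiftingProperty hf
  exact hP _ _ ⟨h.i, h.r, h.retract⟩ hp

theorem RetractClosed.inverseImage {M : Type u₁} [Category.{v₁} M]
    {K : Type u₂} [Category.{v₂} K] {P : MorphismProperty M} (hP : RetractClosed P)
    (V : K ⥤ M) : RetractClosed (P.inverseImage V) := by
  rintro X Y X' Y' f g ⟨i, r, hir⟩ hg
  exact hP _ _ ⟨V.mapArrow.map i, V.mapArrow.map r,
    (V.mapArrow.map_comp i r).symm.trans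
      ((congrArg V.mapArrow.map hir).trans (V.mapArrow.map_id _))⟩ hg

theorem TwoOfThree.inverseImage {M : Type u₁} [Category.{v₁} M]
    {K : Type u₂} [Category.{v₂} K] {W : MorphismProperty M} (hW : TwoOfThree W)
    (V : K ⥤ M) : TwoOfThree (W.inverseImage V) := by
  simp only [TwoOfThree, MorphismProperty.inverseImage_iff, V.map_comp]
  exact ⟨fun _ _ _ _ _ => hW.1 _ _, fun _ _ _ _ _ => hW.2.1 _ _,
    fun _ _ _ _ _ => hW.2.2 _ _⟩

/-- **Left-induced model structure criterion.** Given a model category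
`(M, F, C, W)`, a bicomplete category `K`, and an adjunction `V ⊣ R` with
`V : K ⥤ M`, such that the left-induced weak factorization systems exist on
`K`, the left-induced model structure (cofibrations `V⁻¹C`, weak equivalences
`V⁻¹W`, fibrations `rlp (V⁻¹(C ⊓ W))`) exists on `K` if and only if
`rlp (V⁻¹C) ⊆ V⁻¹W`. -/
theorem leftInduced_iff_acyclicity
    {M : Type u₁} [Category.{v₁} M] [HasLimits M] [HasColimits M]
    {K : Type u₂} [Category.{v₂} K] [HasLimits K] [HasColimits K]
    (F C W : MorphismProperty M)
    (hM : IsModelCategory F C W)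
    (V : K ⥤ M) (R : M ⥤ K) (adj : V ⊣ R)
    (hwfs₁ : IsWFS (C.inverseImage V) (rlp (C.inverseImage V)))
    (hwfs₂ : IsWFS ((C ⊓ W).inverseImage V) (rlp ((C ⊓ W).inverseImage V))) :
    IsModelCategory (rlp ((C ⊓ W).inverseImage V)) (C.inverseImage V)
        (W.inverseImage V) ↔
      rlp (C.inverseImage V) ≤ W.inverseImage V := by
  constructor
  · intro hK X Y f hf
    obtain ⟨Z, i, p, hi, -, hpW, hip⟩ := hK.fact_cof_afib f
    exact hK.retract_weq.of_hasLiftingProperty hip (hf i hi) hpW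
  · intro hacyc
    have hW := hM.two_of_three.inverseImage V
    exact
      { two_of_three := hW
        retract_fib := retractClosed_rlp _
        retract_cof := hM.retract_cof.inverseImage V
        retract_weq := hM.retract_weq.inverseImage V
        lift_acof_fib := fun _ _ _ _ i _ hiC hiW hp => hp i ⟨hiC, hiW⟩
        lift_cof_afib := by
          intro A B X Y i p hi hpF hpW
          obtain ⟨Z, j, q, hj, hq, hjq⟩ := hwfs₁.factor p
          have hjW : W.inverseImage V j := hW.2.1 j q (hacyc _ hq) (hjq ▸ hpW)
          exact (retractClosed_rlp _).of_hasLiftingProperty hjq (hpF j ⟨hj, hjW⟩) hq i hi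
        fact_acof_fib := fun X Y f => by
          obtain ⟨Z, i, p, hi, hp, hip⟩ := hwfs₂.factor f
          exact ⟨Z, i, p, hi.1, hi.2, hp, hip⟩
        fact_cof_afib := fun X Y f => by
          obtain ⟨Z, i, p, hi, hp, hip⟩ := hwfs₁.factor f
          exact ⟨Z, i, p, hi, rlp_antitone (fun _ _ _ h => h.1) _ hp, hacyc _ hp, hip⟩ }

end InducedModel
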